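/- For every integer k ≥ 0 and real α > −1, ∫_0^∞ x^{α+1} (ln x) · [L_k^{(α)}(x)]² e^{−x} dx = (Γ(k+α+1)/k!) · [1 + 2k + (2k+α+1)·ψ(k+α+1)], where ψ = Γ'/Γ is the digamma function. -/

import Mathlib

open MeasureTheory

noncomputable section

/-- The generalized Laguerre polynomial
`L_k^{(α)}(x) = ∑_{j=0}^k (−1)^j [Γ(k+α+1)/(Γ(j+α+1)(k−j)!)] x^j/j!`. -/
def laguerre (α : ℝ) (k : ℕ) (x : ℝ) : ℝ :=
  ∑ j ∈ Finset.range (k + 1),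
    (-1 : ℝ) ^ j *
      (Real.Gamma (k + α + 1) / (Real.Gamma (j + α + 1) * (Nat.factorial (k - j)))) *
      x ^ j / (Nat.factorial j)

/-- The digamma function `ψ = Γ'/Γ` (on the reals). -/
def digamma (x : ℝ) : ℝ := deriv Real.Gamma x / Real.Gamma x

/-- The integrals `∫ x in (0, ∞), x ^ (s - 1) * log x * exp (-x)` converge for `0 < s`, with value
`deriv Real.Gamma s`. -/
theorem integrableOn_and_integral_rpow_log_exp {s : ℝ} (hs : 0 < s) :
    IntegrableOn (fun x : ℝ ↦ x ^ (s - 1) * Real.log x * Real.exp (-x)) (Set.Ioi 0) ∧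
      ∫ x in Set.Ioi (0 : ℝ), x ^ (s - 1) * Real.log x * Real.exp (-x) = deriv Real.Gamma s := by
  have hofReal : ∀ x ∈ Set.Ioi (0 : ℝ),
      (x : ℂ) ^ ((s : ℂ) - 1) * ((Real.log x : ℂ) * (Real.exp (-x) : ℂ)) =
        ((x ^ (s - 1) * Real.log x * Real.exp (-x) : ℝ) : ℂ) := by
    intro x hx
    push_cast [Complex.ofReal_cpow (le_of_lt hx)]
    ring
  constructor
  · have hconv : MellinConvergent (fun t : ℝ ↦ Real.log t • (Real.exp (-t) : ℂ)) (s : ℂ) := by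
      refine (mellin_hasDerivAt_of_isBigO_rpow (a := s + 1) (b := 0) ?_ ?_ ?_ ?_ ?_).1
      · refine (Continuous.continuousOn ?_).locallyIntegrableOn measurableSet_Ioi
        fun_prop
      · rw [← Asymptotics.isBigO_norm_left]
        simp_rw [Complex.norm_real, Asymptotics.isBigO_norm_left]
        simpa only [neg_one_mul] using
          (isLittleO_exp_neg_mul_rpow_atTop zero_lt_one _).isBigO
      · simp
      · simp_rw [neg_zero, Real.rpow_zero]
        refine Asymptotics.isBigO_const_of_tendsto
          (?_ : Filter.Tendsto _ _ (nhds (Complex.ofReal (Real.exp (-0))))) (by simp)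
        exact (Continuous.continuousWithinAt (by fun_prop))
      · simpa using hs
    have hcomplex : IntegrableOn
        (fun x : ℝ ↦ ((x ^ (s - 1) * Real.log x * Real.exp (-x) : ℝ) : ℂ)) (Set.Ioi 0) := by
      refine IntegrableOn.congr_fun hconv (fun x hx ↦ ?_) measurableSet_Ioi
      rw [← hofReal x hx]
      simp
    exact hcomplex.re
  · have hderiv : HasDerivAt Complex.Gamma
        (∫ t : ℝ in Set.Ioi 0, (t : ℂ) ^ ((s : ℂ) - 1) * (Real.log t * Real.exp (-t))) s := by
      refine (Complex.hasDerivAt_GammaIntegral (s := (s : ℂ)) (by simpa using hs)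
        ).congr_of_eventuallyEq ?_
      have : IsOpen {z : ℂ | 0 < z.re} := Complex.continuous_re.isOpen_preimage _ isOpen_Ioi
      filter_upwards [this.mem_nhds (by simpa using hs)] with z hz
        using Complex.Gamma_eq_integral hz
    rw [setIntegral_congr_fun measurableSet_Ioi hofReal, integral_complex_ofReal] at hderiv
    have := hderiv.real_of_complex
    simp only [Complex.Gamma_ofReal, Complex.ofReal_re] at this
    exact this.deriv.symm

/-- The integral of a product of two polynomials against the weight `x ^ β * log x * exp (-x)`,
in terms of the derivative of the Gamma function. -/
theorem integrableOn_and_integral_rpow_log_exp_sum_mul_sum {β : ℝ} (hβ : -1 < β)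
    (s t : Finset ℕ) (a b : ℕ → ℝ) :
    IntegrableOn (fun x : ℝ ↦ x ^ β * Real.log x *
      ((∑ i ∈ s, a i * x ^ i) * ∑ j ∈ t, b j * x ^ j) * Real.exp (-x)) (Set.Ioi 0) ∧
    ∫ x in Set.Ioi (0 : ℝ), x ^ β * Real.log x *
      ((∑ i ∈ s, a i * x ^ i) * ∑ j ∈ t, b j * x ^ j) * Real.exp (-x) =
      ∑ j ∈ t, b j * ∑ i ∈ s, a i * deriv Real.Gamma (β + 1 + j + i) := by
  have hexpand : ∀ x ∈ Set.Ioi (0 : ℝ),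
      ∑ j ∈ t, ∑ i ∈ s,
        b j * a i * (x ^ ((β + 1 + j + i) - 1) * Real.log x * Real.exp (-x)) =
      x ^ β * Real.log x *
        ((∑ i ∈ s, a i * x ^ i) * ∑ j ∈ t, b j * x ^ j) * Real.exp (-x) := by
    intro x hx
    simp only [Finset.mul_sum, Finset.sum_mul]
    refine Finset.sum_congr rfl fun j _ ↦ Finset.sum_congr rfl fun i _ ↦ ?_
    rw [show β + 1 + j + i - 1 = β + j + i by ring, Real.rpow_add_natCast (ne_of_gt hx),
      Real.rpow_add_natCast (ne_of_gt hx)]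
    ring
  have hpos : ∀ i j : ℕ, 0 < β + 1 + j + i := fun i j ↦ by
    have : (0 : ℝ) < β + 1 := by linarith
    positivity
  have hint : ∀ i j : ℕ, IntegrableOn (fun x : ℝ ↦
      b j * a i * (x ^ ((β + 1 + j + i) - 1) * Real.log x * Real.exp (-x))) (Set.Ioi 0) :=
    fun i j ↦ (integrableOn_and_integral_rpow_log_exp (hpos i j)).1.const_mul _
  constructor
  · refine IntegrableOn.congr_fun ?_ hexpand measurableSet_Ioi
    exact integrable_finsetSum _ fun j _ ↦ integrable_finsetSum _ fun i _ ↦ hint i j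
  · rw [← setIntegral_congr_fun measurableSet_Ioi hexpand,
      integral_finsetSum _ fun j _ ↦ integrable_finsetSum _ fun i _ ↦ hint i j]
    refine Finset.sum_congr rfl fun j _ ↦ ?_
    rw [integral_finsetSum _ fun i _ ↦ hint i j, Finset.mul_sum]
    refine Finset.sum_congr rfl fun i _ ↦ ?_
    rw [integral_const_mul, (integrableOn_and_integral_rpow_log_exp (hpos i j)).2, mul_assoc]

/-- The coefficient of `x ^ j` in `laguerre α k x`. -/
def laguerreCoeff (α : ℝ) (k j : ℕ) : ℝ :=
  (-1) ^ j * (Real.Gamma (k + α + 1) / Real.Gamma (j + α + 1)) * (k.choose j / k.factorial)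

theorem laguerre_eq_sum_coeff (α : ℝ) (k : ℕ) (x : ℝ) :
    laguerre α k x = ∑ j ∈ Finset.range (k + 1), laguerreCoeff α k j * x ^ j := by
  refine Finset.sum_congr rfl fun j hj ↦ ?_
  rw [laguerreCoeff, Nat.cast_choose ℝ (Finset.mem_range_succ_iff.mp hj)]
  have := k.factorial_ne_zero
  field_simp

theorem Gamma_natCast_add_ne_zero {α : ℝ} (hα : -1 < α) (j : ℕ) :
    Real.Gamma (j + α + 1) ≠ 0 := by
  have : (0 : ℝ) ≤ j := j.cast_nonneg
  exact (Real.Gamma_pos_of_pos (by linarith)).ne'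

theorem laguerreCoeff_of_lt (α : ℝ) {k j : ℕ} (h : k < j) : laguerreCoeff α k j = 0 := by
  simp [laguerreCoeff, Nat.choose_eq_zero_of_lt h]

theorem laguerreCoeff_self {α : ℝ} (hα : -1 < α) (k : ℕ) :
    laguerreCoeff α k k = (-1) ^ k / k.factorial := by
  rw [laguerreCoeff, div_self (Gamma_natCast_add_ne_zero hα k)]
  simp [div_eq_mul_inv]

theorem laguerreCoeff_mul_Gamma {α : ℝ} (hα : -1 < α) {k j : ℕ} (h : j ≤ k) :
    laguerreCoeff α k j * Real.Gamma (j + α + 1) =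
      (-1) ^ j * Real.Gamma (k + α + 1) / (j.factorial * (k - j).factorial) := by
  have := Gamma_natCast_add_ne_zero hα j
  have := k.factorial_ne_zero
  rw [laguerreCoeff, Nat.cast_choose ℝ h]
  field_simp

theorem succ_mul_laguerreCoeff_succ_zero {α : ℝ} (hα : -1 < α) (k : ℕ) :
    (k + 1) * laguerreCoeff α (k + 1) 0 = (k + 1 + α) * laguerreCoeff α k 0 := by
  have hk : (0 : ℝ) ≤ k := k.cast_nonneg
  have hG : Real.Gamma ((k + 1 : ℕ) + α + 1) = (k + 1 + α) * Real.Gamma (k + α + 1) := by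
    rw [← add_right_comm (k : ℝ), ← Real.Gamma_add_one (by linarith)]
    push_cast
    ring_nf
  have := k.factorial_ne_zero
  have := Gamma_natCast_add_ne_zero hα 0
  simp only [laguerreCoeff, hG, Nat.factorial_succ, Nat.choose_zero_right]
  push_cast at *
  field_simp

theorem succ_mul_laguerreCoeff_succ_succ {α : ℝ} (hα : -1 < α) (k j : ℕ) :
    (k + 1) * laguerreCoeff α (k + 1) (j + 1) =
      (k + 1 + α) * laguerreCoeff α k (j + 1) - laguerreCoeff (α + 1) k j := by
  have hk : (0 : ℝ) ≤ k := k.cast_nonneg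
  have hG : Real.Gamma ((k + 1 : ℕ) + α + 1) = (k + 1 + α) * Real.Gamma (k + α + 1) := by
    rw [← add_right_comm (k : ℝ), ← Real.Gamma_add_one (by linarith)]
    push_cast
    ring_nf
  have hG' : Real.Gamma (k + (α + 1) + 1) = (k + 1 + α) * Real.Gamma (k + α + 1) := by
    rw [← hG]
    push_cast
    ring_nf
  have hj : Real.Gamma (j + (α + 1) + 1) = Real.Gamma ((j + 1 : ℕ) + α + 1) := by
    push_cast
    ring_nf
  have := k.factorial_ne_zero
  have := Gamma_natCast_add_ne_zero hα (j + 1)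
  simp only [laguerreCoeff, hG, hG', hj, Nat.factorial_succ, Nat.choose_succ_succ]
  push_cast at *
  field_simp
  ring

theorem laguerreCoeff_succ_eq_sub {α : ℝ} (hα : -1 < α) (k j : ℕ) :
    laguerreCoeff α (k + 1) j =
      laguerreCoeff (α + 1) (k + 1) j - laguerreCoeff (α + 1) k j := by
  rcases lt_or_ge (k + 1) j with h | h
  · simp [laguerreCoeff_of_lt _ h, laguerreCoeff_of_lt _ (Nat.lt_of_succ_lt h)]
  have hk : (0 : ℝ) ≤ k := k.cast_nonneg
  have hj : (0 : ℝ) ≤ j := j.cast_nonneg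
  have hG : Real.Gamma ((k + 1 : ℕ) + (α + 1) + 1) =
      (k + α + 2) * Real.Gamma (k + α + 2) := by
    rw [← Real.Gamma_add_one (by linarith)]
    push_cast
    ring_nf
  have hG₁ : Real.Gamma ((k + 1 : ℕ) + α + 1) = Real.Gamma (k + α + 2) := by
    push_cast
    ring_nf
  have hG₂ : Real.Gamma (k + (α + 1) + 1) = Real.Gamma (k + α + 2) := by
    ring_nf
  have hj' : Real.Gamma (j + (α + 1) + 1) = (j + α + 1) * Real.Gamma (j + α + 1) := by
    rw [← Real.Gamma_add_one (by linarith)]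
    ring_nf
  have hchoose : (k.choose j : ℝ) * (k + 1) = (k + 1).choose j * (k + 1 - j) := by
    have := Nat.choose_mul_succ_eq k j
    zify [h] at this
    exact_mod_cast this
  have := k.factorial_ne_zero
  have := Gamma_natCast_add_ne_zero hα j
  have : (j : ℝ) + α + 1 ≠ 0 := by linarith
  simp only [laguerreCoeff, hG, hG₁, hG₂, hj', Nat.factorial_succ]
  push_cast
  field_simp
  linear_combination Real.Gamma (k + α + 2) * hchoose

theorem laguerre_succ_eq_sub {α : ℝ} (hα : -1 < α) (k : ℕ) (x : ℝ) :
    laguerre α (k + 1) x = laguerre (α + 1) (k + 1) x - laguerre (α + 1) k x := by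
  have hk : laguerre (α + 1) k x =
      ∑ j ∈ Finset.range (k + 1 + 1), laguerreCoeff (α + 1) k j * x ^ j := by
    rw [Finset.sum_range_succ, laguerreCoeff_of_lt _ k.lt_succ_self, laguerre_eq_sum_coeff]
    ring
  rw [hk, laguerre_eq_sum_coeff, laguerre_eq_sum_coeff, ← Finset.sum_sub_distrib]
  refine Finset.sum_congr rfl fun j _ ↦ ?_
  rw [laguerreCoeff_succ_eq_sub hα]
  ring

/-- A form of the Chu–Vandermonde identity: the value of
`∫ x in (0, ∞), x ^ (s - 1) * laguerre α k x * exp (-x)`. -/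
theorem sum_laguerreCoeff_mul_Gamma {α : ℝ} (hα : -1 < α) {s : ℝ} (hs : 0 < s) (k : ℕ) :
    ∑ j ∈ Finset.range (k + 1), laguerreCoeff α k j * Real.Gamma (s + j) =
      Real.Gamma s / k.factorial * ∏ r ∈ Finset.range k, ((r : ℝ) - (s - α - 1)) := by
  induction k generalizing α s with
  | zero => simp [laguerreCoeff_self hα]
  | succ k ih =>
    have h₀ := ih hα hs
    have h₁ := ih (α := α + 1) (by linarith) (s := s + 1) (by linarith)
    rw [show s + 1 - (α + 1) - 1 = s - α - 1 by ring, Real.Gamma_add_one hs.ne'] at h₁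
    have hext : ∑ j ∈ Finset.range (k + 1), laguerreCoeff α k j * Real.Gamma (s + j) =
        ∑ j ∈ Finset.range (k + 1), laguerreCoeff α k (j + 1) * Real.Gamma (s + 1 + j) +
          laguerreCoeff α k 0 * Real.Gamma s := by
      rw [← add_zero (∑ j ∈ Finset.range (k + 1), laguerreCoeff α k j * Real.Gamma (s + j)),
        ← zero_mul (Real.Gamma (s + (k + 1 : ℕ))), ← laguerreCoeff_of_lt α k.lt_succ_self,
        ← Finset.sum_range_succ (fun j : ℕ ↦ laguerreCoeff α k j * Real.Gamma (s + j)),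
        Finset.sum_range_succ']
      simp [add_comm, add_left_comm]
    have hrec : (k + 1 : ℝ) *
        ∑ j ∈ Finset.range (k + 1 + 1), laguerreCoeff α (k + 1) j * Real.Gamma (s + j) =
        (k + 1 + α) * ∑ j ∈ Finset.range (k + 1), laguerreCoeff α k j * Real.Gamma (s + j) -
          ∑ j ∈ Finset.range (k + 1), laguerreCoeff (α + 1) k j * Real.Gamma (s + 1 + j) := by
      rw [hext, Finset.sum_range_succ', mul_add, mul_add, ← mul_assoc _ (laguerreCoeff α (k + 1) 0),
        succ_mul_laguerreCoeff_succ_zero hα, add_sub_right_comm, Finset.mul_sum, Finset.mul_sum,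
        ← Finset.sum_sub_distrib]
      congr 1
      · refine Finset.sum_congr rfl fun j _ ↦ ?_
        rw [← mul_assoc, succ_mul_laguerreCoeff_succ_succ hα]
        push_cast
        ring_nf
      · simp [mul_assoc]
    rw [h₀, h₁] at hrec
    have := k.factorial_ne_zero
    refine mul_left_cancel₀ (k.cast_add_one_ne_zero (R := ℝ)) (hrec.trans ?_)
    rw [Finset.prod_range_succ, Nat.factorial_succ]
    push_cast
    field_simp
    ring

theorem prod_range_sub_of_lt {k j : ℕ} (h : j < k) :
    ∏ r ∈ Finset.range k, ((r : ℝ) - j) = 0 :=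
  Finset.prod_eq_zero (Finset.mem_range.mpr h) (sub_self _)

theorem prod_range_sub_self (k : ℕ) :
    ∏ r ∈ Finset.range k, ((r : ℝ) - k) = (-1) ^ k * k.factorial := by
  rw [← Finset.prod_range_reflect, ← Finset.prod_range_add_one_eq_factorial, Nat.cast_prod,
    ← Finset.card_range k, ← Finset.prod_const, Finset.card_range, ← Finset.prod_mul_distrib]
  refine Finset.prod_congr rfl fun r hr ↦ ?_
  have : r + 1 ≤ k := Finset.mem_range.mp hr
  rw [Nat.sub_sub, Nat.cast_sub (by omega)]
  push_cast
  ring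

theorem hasDerivAt_prod_range_sub (k : ℕ) (u : ℝ) :
    HasDerivAt (fun u : ℝ ↦ ∏ r ∈ Finset.range k, ((r : ℝ) - u))
      (-∑ i ∈ Finset.range k, ∏ r ∈ (Finset.range k).erase i, ((r : ℝ) - u)) u := by
  have := HasDerivAt.fun_finsetProd (u := Finset.range k) (x := u)
    (f := fun r u ↦ (r : ℝ) - u) (f' := fun _ ↦ -1)
    (fun r _ ↦ by simpa using (hasDerivAt_id u).const_sub (r : ℝ))
  simpa using this

theorem hasDerivAt_prod_range_sub_self (k : ℕ) :
    HasDerivAt (fun u : ℝ ↦ ∏ r ∈ Finset.range k, ((r : ℝ) - u))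
      ((-1) ^ k * k.factorial * ∑ r ∈ Finset.range k, ((k : ℝ) - r)⁻¹) k := by
  convert hasDerivAt_prod_range_sub k k using 1
  rw [← prod_range_sub_self, Finset.mul_sum, ← Finset.sum_neg_distrib]
  refine Finset.sum_congr rfl fun i hi ↦ ?_
  have hne : (i : ℝ) - k ≠ 0 := sub_ne_zero.mpr (by exact_mod_cast (Finset.mem_range.mp hi).ne)
  rw [← Finset.mul_prod_erase _ _ hi, ← neg_sub (i : ℝ), inv_neg]
  field_simp

theorem hasDerivAt_prod_range_sub_of_lt {k j : ℕ} (h : j < k) :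
    HasDerivAt (fun u : ℝ ↦ ∏ r ∈ Finset.range k, ((r : ℝ) - u))
      (-((-1) ^ j * j.factorial * (k - 1 - j).factorial)) j := by
  convert hasDerivAt_prod_range_sub k j using 2
  rw [Finset.sum_eq_single j]
  · obtain ⟨m, rfl⟩ := Nat.exists_eq_add_of_lt h
    have hrange : (Finset.range (j + m + 1)).erase j =
        Finset.range j ∪ (Finset.range m).image (fun r ↦ j + 1 + r) := by
      ext r
      simp only [Finset.mem_erase, Finset.mem_range, Finset.mem_union, Finset.mem_image]
      constructor
      · intro hr
        rcases lt_or_ge r j with h' | h'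
        · exact Or.inl h'
        · exact Or.inr ⟨r - (j + 1), by omega, by omega⟩
      · rintro (hr | ⟨a, ha, rfl⟩) <;> omega
    rw [hrange, Finset.prod_union, Finset.prod_image (by intro a _ b _ hab; simpa using hab),
      prod_range_sub_self, show j + m + 1 - 1 - j = m by omega,
      ← Finset.prod_range_add_one_eq_factorial m]
    · push_cast
      congr 1
      exact Finset.prod_congr rfl fun r _ ↦ by ring
    · rw [Finset.disjoint_left]
      intro a ha
      simp only [Finset.mem_range, Finset.mem_image] at ha ⊢
      omega
  · intro i _ hi
    exact Finset.prod_eq_zero (Finset.mem_erase.mpr ⟨hi.symm, Finset.mem_range.mpr h⟩) (sub_self _)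
  · intro hj
    exact absurd (Finset.mem_range.mpr h) hj

theorem Real.hasDerivAt_Gamma_of_pos {s : ℝ} (hs : 0 < s) :
    HasDerivAt Real.Gamma (deriv Real.Gamma s) s := by
  refine (Real.differentiableAt_Gamma fun m ↦ ?_).hasDerivAt
  have : (0 : ℝ) ≤ m := m.cast_nonneg
  linarith

theorem sum_laguerreCoeff_mul_deriv_Gamma {α : ℝ} (hα : -1 < α) (k j : ℕ) {p' : ℝ}
    (hp : HasDerivAt (fun u : ℝ ↦ ∏ r ∈ Finset.range k, ((r : ℝ) - u)) p' j) :
    ∑ i ∈ Finset.range (k + 1), laguerreCoeff α k i * deriv Real.Gamma (α + 1 + j + i) =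
      (deriv Real.Gamma (j + α + 1) * ∏ r ∈ Finset.range k, ((r : ℝ) - j) +
        Real.Gamma (j + α + 1) * p') / k.factorial := by
  have hs : 0 < α + 1 + j := by
    have : (0 : ℝ) ≤ j := j.cast_nonneg
    linarith
  have hleft : HasDerivAt
      (fun s : ℝ ↦ ∑ i ∈ Finset.range (k + 1), laguerreCoeff α k i * Real.Gamma (s + i))
      (∑ i ∈ Finset.range (k + 1), laguerreCoeff α k i * deriv Real.Gamma (α + 1 + j + i))
      (α + 1 + j) := by
    refine HasDerivAt.fun_sum fun i _ ↦ HasDerivAt.const_mul _ ?_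
    exact (Real.hasDerivAt_Gamma_of_pos (by positivity)).comp_add_const _ _
  have hprod : HasDerivAt
      (fun s : ℝ ↦ ∏ r ∈ Finset.range k, ((r : ℝ) - (s - α - 1))) p' (α + 1 + j) := by
    have hj : α + 1 + (j : ℝ) - (α + 1) = j := by ring
    have := HasDerivAt.comp_sub_const (α + 1 + j : ℝ) (α + 1) (by rwa [hj])
    simpa only [sub_sub] using this
  have hright := ((Real.hasDerivAt_Gamma_of_pos hs).div_const (k.factorial : ℝ)).mul hprod
  have heq := hleft.unique (hright.congr_of_eventuallyEq (by
    filter_upwards [lt_mem_nhds hs] with s hs' using sum_laguerreCoeff_mul_Gamma hα hs' k))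
  rw [heq, show α + 1 + (j : ℝ) - α - 1 = j by ring, show α + 1 + (j : ℝ) = j + α + 1 by ring]
  ring

/-- `∫ x in (0, ∞), x ^ α * log x * laguerre α k x ^ 2 * exp (-x)`, as a finite sum. -/
theorem sum_laguerreCoeff_mul_sum_self {α : ℝ} (hα : -1 < α) (k : ℕ) :
    ∑ j ∈ Finset.range (k + 1), laguerreCoeff α k j *
      ∑ i ∈ Finset.range (k + 1), laguerreCoeff α k i * deriv Real.Gamma (α + 1 + j + i) =
      deriv Real.Gamma (k + α + 1) / k.factorial := by
  have hk : (k.factorial : ℝ) ≠ 0 := mod_cast k.factorial_ne_zero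
  rw [Finset.sum_range_succ,
    sum_laguerreCoeff_mul_deriv_Gamma hα k k (hasDerivAt_prod_range_sub_self k),
    prod_range_sub_self, laguerreCoeff_self hα]
  have hsum : ∑ j ∈ Finset.range k, laguerreCoeff α k j *
      ∑ i ∈ Finset.range (k + 1), laguerreCoeff α k i * deriv Real.Gamma (α + 1 + j + i) =
      -(Real.Gamma (k + α + 1) / k.factorial * ∑ r ∈ Finset.range k, ((k : ℝ) - r)⁻¹) := by
    rw [Finset.mul_sum, ← Finset.sum_neg_distrib]
    refine Finset.sum_congr rfl fun j hj ↦ ?_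
    have hjk := Finset.mem_range.mp hj
    rw [sum_laguerreCoeff_mul_deriv_Gamma hα k j (hasDerivAt_prod_range_sub_of_lt hjk),
      prod_range_sub_of_lt hjk, mul_zero, zero_add, mul_div_assoc', ← mul_assoc,
      laguerreCoeff_mul_Gamma hα hjk.le]
    obtain ⟨m, rfl⟩ := Nat.exists_eq_add_of_lt hjk
    rw [show j + m + 1 - 1 - j = m by omega, show j + m + 1 - j = m + 1 by omega,
      Nat.factorial_succ m]
    have := j.factorial_ne_zero
    have := m.factorial_ne_zero
    have hm : (j + m + 1 : ℕ) - (j : ℝ) = m + 1 := by push_cast; ring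
    rw [hm]
    have hsq : ((-1 : ℝ) ^ j) ^ 2 = 1 := by rw [← pow_mul, mul_comm, pow_mul]; simp
    push_cast
    field_simp
    rw [hsq]
    ring
  rw [hsum]
  have hsq : ((-1 : ℝ) ^ k) ^ 2 = 1 := by rw [← pow_mul, mul_comm, pow_mul]; simp
  field_simp
  rw [hsq]
  ring

/-- `∫ x in (0, ∞), x ^ α * log x * (laguerre α (k + 1) x * laguerre α k x) * exp (-x)`, as a
finite sum. -/
theorem sum_laguerreCoeff_mul_sum_succ {α : ℝ} (hα : -1 < α) (k : ℕ) :
    ∑ j ∈ Finset.range (k + 1), laguerreCoeff α k j *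
      ∑ i ∈ Finset.range (k + 1 + 1), laguerreCoeff α (k + 1) i *
        deriv Real.Gamma (α + 1 + j + i) =
      -(Real.Gamma (k + α + 1) / k.factorial) := by
  have hk : (k.factorial : ℝ) ≠ 0 := mod_cast k.factorial_ne_zero
  have hterm : ∀ j ∈ Finset.range (k + 1), laguerreCoeff α k j *
      ∑ i ∈ Finset.range (k + 1 + 1), laguerreCoeff α (k + 1) i *
        deriv Real.Gamma (α + 1 + j + i) =
      -(Real.Gamma (k + α + 1) / (k + 1).factorial) := by
    intro j hj
    have hjk := Finset.mem_range.mp hj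
    rw [sum_laguerreCoeff_mul_deriv_Gamma hα (k + 1) j (hasDerivAt_prod_range_sub_of_lt hjk),
      prod_range_sub_of_lt hjk, mul_zero, zero_add, mul_div_assoc', ← mul_assoc,
      laguerreCoeff_mul_Gamma hα (Nat.lt_succ_iff.mp hjk), Nat.add_sub_cancel]
    have := j.factorial_ne_zero
    have := (k - j).factorial_ne_zero
    have hsq : ((-1 : ℝ) ^ j) ^ 2 = 1 := by rw [← pow_mul, mul_comm, pow_mul]; simp
    field_simp
    rw [hsq]
    ring
  rw [Finset.sum_congr rfl hterm, Finset.sum_const, Finset.card_range, Nat.factorial_succ]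
  push_cast [nsmul_eq_mul]
  field_simp

theorem deriv_Gamma_add_one_of_pos {s : ℝ} (hs : 0 < s) :
    deriv Real.Gamma (s + 1) = Real.Gamma s * (1 + s * digamma s) := by
  have hleft := (Real.hasDerivAt_Gamma_of_pos (add_pos hs one_pos)).comp_add_const s 1
  have hright := (hasDerivAt_id s).mul (Real.hasDerivAt_Gamma_of_pos hs)
  have := hleft.unique (hright.congr_of_eventuallyEq (by
    filter_upwards [lt_mem_nhds hs] with t ht using Real.Gamma_add_one ht.ne'))
  have hG := (Real.Gamma_pos_of_pos hs).ne'
  rw [this, digamma]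
  simp only [id]
  field_simp

/-- For `k ≥ 0` and `α > −1`,
`∫_0^∞ x^{α+1} (ln x) [L_k^{(α)}(x)]² e^{−x} dx
  = (Γ(k+α+1)/k!) [1 + 2k + (2k+α+1) ψ(k+α+1)]`. -/
theorem laguerre_log_weighted_integral (k : ℕ) (α : ℝ) (hα : -1 < α) :
    ∫ x in Set.Ioi (0 : ℝ),
        x ^ (α + 1) * Real.log x * (laguerre α k x) ^ 2 * Real.exp (-x) =
      Real.Gamma (k + α + 1) / (Nat.factorial k) *
        (1 + 2 * (k : ℝ) + (2 * (k : ℝ) + α + 1) * digamma (k + α + 1)) := by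
  have hβ : -1 < α + 1 := by linarith
  have hlag (k l : ℕ) := integrableOn_and_integral_rpow_log_exp_sum_mul_sum hβ
    (Finset.range (k + 1)) (Finset.range (l + 1)) (laguerreCoeff (α + 1) k)
    (laguerreCoeff (α + 1) l)
  simp only [← laguerre_eq_sum_coeff] at hlag
  have hpos (k : ℕ) : 0 < (k : ℝ) + α + 1 := by
    have : (0 : ℝ) ≤ k := k.cast_nonneg
    linarith
  have hderiv (k : ℕ) : deriv Real.Gamma (k + (α + 1) + 1) =
      Real.Gamma (k + α + 1) * (1 + (k + α + 1) * digamma (k + α + 1)) := by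
    rw [← add_assoc, deriv_Gamma_add_one_of_pos (hpos k)]
  cases k with
  | zero =>
    have h := (hlag 0 0).2
    rw [sum_laguerreCoeff_mul_sum_self hβ, hderiv] at h
    have hone (β x : ℝ) (hβ : -1 < β) : laguerre β 0 x = 1 := by
      simp [laguerre_eq_sum_coeff, laguerreCoeff_self hβ]
    simp only [hone _ _ hβ] at h
    simp only [hone _ _ hα]
    norm_num at h ⊢
    exact h
  | succ k =>
    have hexpand (x : ℝ) :
        x ^ (α + 1) * Real.log x * laguerre α (k + 1) x ^ 2 * Real.exp (-x) =
        x ^ (α + 1) * Real.log x *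
            (laguerre (α + 1) (k + 1) x * laguerre (α + 1) (k + 1) x) * Real.exp (-x) -
          2 * (x ^ (α + 1) * Real.log x *
            (laguerre (α + 1) (k + 1) x * laguerre (α + 1) k x) * Real.exp (-x)) +
          x ^ (α + 1) * Real.log x *
            (laguerre (α + 1) k x * laguerre (α + 1) k x) * Real.exp (-x) := by
      rw [laguerre_succ_eq_sub hα]
      ring
    simp only [hexpand]
    rw [integral_add ((hlag _ _).1.fun_sub ((hlag _ _).1.const_mul 2)) (hlag _ _).1,
      integral_sub (hlag _ _).1 ((hlag _ _).1.const_mul 2), integral_const_mul,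
      (hlag _ _).2, (hlag _ _).2, (hlag _ _).2, sum_laguerreCoeff_mul_sum_self hβ,
      sum_laguerreCoeff_mul_sum_succ hβ, sum_laguerreCoeff_mul_sum_self hβ, hderiv (k + 1)]
    have hk : (k : ℝ) + (α + 1) + 1 = (k + 1 : ℕ) + α + 1 := by push_cast; ring
    have hG := (Real.Gamma_pos_of_pos (hpos (k + 1))).ne'
    have hfac : (k.factorial : ℝ) ≠ 0 := mod_cast k.factorial_ne_zero
    have hψ : deriv Real.Gamma ((k + 1 : ℕ) + α + 1) =
        Real.Gamma ((k + 1 : ℕ) + α + 1) * digamma ((k + 1 : ℕ) + α + 1) := by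
      rw [digamma]
      field_simp
    rw [hk, hψ, Nat.factorial_succ]
    generalize Real.Gamma ((k + 1 : ℕ) + α + 1) = G
    generalize digamma ((k + 1 : ℕ) + α + 1) = ψ
    push_cast
    field_simp
    ring
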